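/- Let V = V_1 ⊕ V_2 ⊕ V_4 and R = O(V)^{SL(2,ℂ)}. Then R has no homogeneous system of parameters with degrees 2, 2, 3, 3, 3, 4, 5. (Indeed, every homogeneous invariant of degree at most 5 vanishes at the point (x, 0, 4xy³) ∈ V, which does not lie in the nullcone of V.) -/

import Mathlib

open MvPolynomial

noncomputable section

namespace BinInv

/-- `k`-fold partial derivative with respect to the variable `v`. -/
def pd {A : Type*} [CommSemiring A] (v : Fin 2) (k : ℕ)
    (f : MvPolynomial (Fin 2) A) : MvPolynomial (Fin 2) A :=
  (fun g => MvPolynomial.pderiv v g)^[k] f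

/-- The `p`-th transvectant of binary forms `g`, `h` of degrees `m`, `n`,
with coefficients in a commutative `ℂ`-algebra `A`. -/
def transvectant {A : Type*} [CommRing A] [Algebra ℂ A] (m n p : ℕ)
    (g h : MvPolynomial (Fin 2) A) : MvPolynomial (Fin 2) A :=
  algebraMap ℂ (MvPolynomial (Fin 2) A)
      ((((m - p).factorial * (n - p).factorial : ℕ) : ℂ) /
        (((m.factorial * n.factorial : ℕ)) : ℂ)) *
    ∑ i ∈ Finset.range (p + 1),
      algebraMap ℂ (MvPolynomial (Fin 2) A) ((-1 : ℂ) ^ i * (p.choose i : ℂ)) *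
        (pd 0 (p - i) (pd 1 i g) * pd 0 i (pd 1 (p - i) h))

variable {p : ℕ}

/-- Index type for the coefficients of a system of binary forms of degrees `n 0, …, n (p-1)`:
the space `V = V_{n 0} ⊕ … ⊕ V_{n (p-1)}` is identified with `Idx n → ℂ`. -/
abbrev Idx (n : Fin p → ℕ) : Type := Σ i : Fin p, Fin (n i + 1)

/-- The binary form of degree `n i` with coefficient vector `c`. -/
def formAt (n : Fin p → ℕ) (c : Idx n → ℂ) (i : Fin p) : MvPolynomial (Fin 2) ℂ :=
  ∑ k : Fin (n i + 1), C (c ⟨i, k⟩) * X 0 ^ (n i - (k : ℕ)) * X 1 ^ (k : ℕ)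

/-- The substitution action of `SL(2,ℂ)` on binary forms: `(g • f)(v) = f (g⁻¹ • v)`. -/
def sl2Act (g : Matrix.SpecialLinearGroup (Fin 2) ℂ) (f : MvPolynomial (Fin 2) ℂ) :
    MvPolynomial (Fin 2) ℂ :=
  aeval (fun i => ∑ j, C ((↑(g⁻¹) : Matrix (Fin 2) (Fin 2) ℂ) i j) * X j) f

/-- The coefficient of `x^(n-k) y^k` in a binary form. -/
def coeffAt (n : Fin p → ℕ) (j : Idx n) (f : MvPolynomial (Fin 2) ℂ) : ℂ :=
  MvPolynomial.coeff
    (Finsupp.single 0 (n j.1 - (j.2 : ℕ)) + Finsupp.single 1 (j.2 : ℕ)) f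

/-- The induced action of `SL(2,ℂ)` on points of `V`, in coefficient coordinates. -/
def actPt (n : Fin p → ℕ) (g : Matrix.SpecialLinearGroup (Fin 2) ℂ) (c : Idx n → ℂ) :
    Idx n → ℂ :=
  fun j => coeffAt n j (sl2Act g (formAt n c j.1))

/-- A polynomial function on `V` is invariant if it is constant on `SL(2,ℂ)`-orbits. -/
def IsInvariant (n : Fin p → ℕ) (P : MvPolynomial (Idx n) ℂ) : Prop :=
  ∀ (g : Matrix.SpecialLinearGroup (Fin 2) ℂ) (c : Idx n → ℂ),
    eval (actPt n g c) P = eval c P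

/-- The invariant ring `R = O(V)^{SL(2,ℂ)}` as a subalgebra of `O(V)`. -/
def invariantRing (n : Fin p → ℕ) : Subalgebra ℂ (MvPolynomial (Idx n) ℂ) where
  carrier := {P | IsInvariant n P}
  mul_mem' := fun ha hb g c => by
    simp only [map_mul]; rw [ha g c, hb g c]
  one_mem' := fun g c => by simp
  add_mem' := fun ha hb g c => by
    simp only [map_add]; rw [ha g c, hb g c]
  zero_mem' := fun g c => by simp
  algebraMap_mem' := fun r g c => by simp

/-- The nullcone: the points of `V` where every homogeneous invariant of positive
degree vanishes. -/
def Nullcone (n : Fin p → ℕ) : Set (Idx n → ℂ) :=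
  {c | ∀ P ∈ invariantRing n, ∀ d : ℕ, 0 < d → P.IsHomogeneous d → eval c P = 0}

/-- `P` is a homogeneous system of parameters of the invariant ring, with degrees `d`:
the `P j` are homogeneous invariants of positive degrees `d j`, algebraically independent
over `ℂ`, and the invariant ring is integral over the subalgebra they generate. -/
def IsHSOP (n : Fin p → ℕ) {k : ℕ} (P : Fin k → MvPolynomial (Idx n) ℂ)
    (d : Fin k → ℕ) : Prop :=
  (∀ j, P j ∈ invariantRing n) ∧ (∀ j, 0 < d j) ∧
    (∀ j, (P j).IsHomogeneous (d j)) ∧ AlgebraicIndependent ℂ P ∧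
    ∀ x ∈ invariantRing n, IsIntegral (↥(Algebra.adjoin ℂ (Set.range P))) x

/-- `r` is the minimal number of generators of the invariant ring. -/
def IsMinimalNumGens (n : Fin p → ℕ) (r : ℕ) : Prop :=
  IsLeast {k | ∃ S : Finset (MvPolynomial (Idx n) ℂ),
    S.card = k ∧ Algebra.adjoin ℂ (S : Set (MvPolynomial (Idx n) ℂ)) = invariantRing n} r

/-- The invariant ring has minimal number of generators `r`, realized by a minimal
system of homogeneous generators of degrees `d 0, …, d (r-1)`. -/
def HasMinimalGens (n : Fin p → ℕ) {r : ℕ} (d : Fin r → ℕ) : Prop :=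
  IsMinimalNumGens n r ∧
    ∃ G : Fin r → MvPolynomial (Idx n) ℂ, Function.Injective G ∧
      (∀ j, (G j).IsHomogeneous (d j)) ∧
      Algebra.adjoin ℂ (Set.range G) = invariantRing n

/-- The generic binary form of degree `n i`, whose coefficients are the corresponding
coordinate functions on `V`. -/
def genForm (n : Fin p → ℕ) (i : Fin p) :
    MvPolynomial (Fin 2) (MvPolynomial (Idx n) ℂ) :=
  ∑ k : Fin (n i + 1), C (X ⟨i, k⟩) * X 0 ^ (n i - (k : ℕ)) * X 1 ^ (k : ℕ)

end BinInv

end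

noncomputable section

namespace BinInv

/-- The point `(x, 0, 4xy³)` of `V = V₁ ⊕ V₂ ⊕ V₄`, in coefficient coordinates. -/
def ptV124 : Idx ![1, 2, 4] → ℂ := fun j =>
  if (j.1 : ℕ) = 0 ∧ (j.2 : ℕ) = 0 then 1
  else if (j.1 : ℕ) = 2 ∧ (j.2 : ℕ) = 3 then 4 else 0

end BinInv

namespace BinInv

variable {n : Fin p → ℕ}

theorem coeffAt_formAt (c : Idx n → ℂ) (j : Idx n) : coeffAt n j (formAt n c j.1) = c j := by
  obtain ⟨i, k⟩ := j
  have key : ∀ l : Fin (n i + 1),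
      (C (c ⟨i, l⟩) * X 0 ^ (n i - (l : ℕ)) * X 1 ^ (l : ℕ) : MvPolynomial (Fin 2) ℂ) =
        monomial (Finsupp.single 0 (n i - (l : ℕ)) + Finsupp.single 1 (l : ℕ)) (c ⟨i, l⟩) := by
    intro l
    rw [X_pow_eq_monomial, X_pow_eq_monomial, C_apply, monomial_mul, monomial_mul]
    simp
  simp only [coeffAt, formAt, key, coeff_sum, coeff_monomial]
  rw [Finset.sum_eq_single k]
  · simp
  · intro l _ hl
    rw [if_neg]
    intro h
    apply hl
    have := DFunLike.congr_fun h 1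
    simpa [Fin.ext_iff] using this
  · simp

/-- To compute the action on points it suffices to compute it on forms. -/
theorem actPt_apply_of_form {g : Matrix.SpecialLinearGroup (Fin 2) ℂ} {c c' : Idx n → ℂ}
    {i : Fin p} (h : sl2Act g (formAt n c i) = formAt n c' i) (k : Fin (n i + 1)) :
    actPt n g c ⟨i, k⟩ = c' ⟨i, k⟩ := by
  rw [actPt, h]
  exact coeffAt_formAt c' ⟨i, k⟩

theorem sl2Act_inv_formAt (h : Matrix.SpecialLinearGroup (Fin 2) ℂ) (c : Idx n → ℂ) (i : Fin p) :
    sl2Act h⁻¹ (formAt n c i) = ∑ k : Fin (n i + 1), C (c ⟨i, k⟩) *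
      (C (h.1 0 0) * X 0 + C (h.1 0 1) * X 1) ^ (n i - (k : ℕ)) *
      (C (h.1 1 0) * X 0 + C (h.1 1 1) * X 1) ^ (k : ℕ) := by
  simp only [formAt, sl2Act, map_sum, map_mul, map_pow, aeval_X, algHom_C, inv_inv,
    Fin.sum_univ_two, algebraMap_eq]

/-- The torus weight of the coefficient coordinate `j`. -/
def weight (n : Fin p → ℕ) (j : Idx n) : ℤ := 2 * ((j.2 : ℕ) : ℤ) - (n j.1 : ℤ)

/-- The torus element of `SL(2,ℂ)` with diagonal entries `2⁻¹` and `2`. -/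
def torus : Matrix.SpecialLinearGroup (Fin 2) ℂ :=
  ⟨!![2⁻¹, 0; 0, 2], by simp [Matrix.det_fin_two]⟩

theorem actPt_torus (c : Idx n → ℂ) :
    actPt n torus⁻¹ c = fun j => (2 : ℂ) ^ weight n j * c j := by
  funext ⟨i, k⟩
  refine actPt_apply_of_form (c' := fun j => (2 : ℂ) ^ weight n j * c j) ?_ k
  rw [sl2Act_inv_formAt, formAt]
  refine Finset.sum_congr rfl fun k _ => ?_
  have hk : (k : ℕ) ≤ n i := Nat.lt_succ_iff.mp k.2
  have h2 : (2 : ℂ) ^ weight n ⟨i, k⟩ = (2⁻¹) ^ (n i - (k : ℕ)) * 2 ^ (k : ℕ) := by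
    rw [inv_pow, ← zpow_natCast, ← zpow_natCast, ← zpow_neg, ← zpow_add₀ two_ne_zero]
    congr 1
    simp only [weight]
    push_cast [hk]
    ring
  have e : torus.1 = !![2⁻¹, 0; 0, 2] := rfl
  simp only [h2, e, Matrix.of_apply, Matrix.cons_val_zero, Matrix.cons_val_one,
    Matrix.cons_val_fin_one, C_0, zero_mul, add_zero, zero_add, mul_pow, C_mul, C_pow]
  ring

theorem coeff_aeval_scale {σ R : Type*} [CommRing R] (a : σ → R) (P : MvPolynomial σ R)
    (m : σ →₀ ℕ) :
    coeff m (aeval (fun j => C (a j) * X j) P) = (m.prod fun j e => a j ^ e) * coeff m P := by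
  classical
  induction P using MvPolynomial.induction_on' with
  | monomial u r =>
    have : aeval (fun j => C (a j) * X j : σ → MvPolynomial σ R) (monomial u r) =
        monomial u ((u.prod fun j e => a j ^ e) * r) := by
      rw [aeval_monomial, monomial_eq (s := u)]
      simp only [mul_pow, Finsupp.prod_mul, map_mul, algebraMap_eq]
      simp only [Finsupp.prod, map_prod, map_pow]
      ring
    rw [this, coeff_monomial, coeff_monomial]
    split_ifs with h
    · rw [h]
    · simp
  | add p q hp hq => rw [map_add, coeff_add, coeff_add, hp, hq, mul_add]

/-- Monomials of invariants have torus weight zero. -/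
theorem weight_eq_zero_of_coeff_ne_zero {P : MvPolynomial (Idx n) ℂ}
    (hP : P ∈ invariantRing n) {m : Idx n →₀ ℕ} (hm : coeff m P ≠ 0) :
    ∑ j, (m j : ℤ) * weight n j = 0 := by
  have h1 : aeval (fun j => C ((2 : ℂ) ^ weight n j) * X j) P = P := by
    apply MvPolynomial.funext
    intro c
    have h := hP torus⁻¹ c
    rw [actPt_torus] at h
    rw [← h, ← MvPolynomial.coe_aeval_eq_eval, ← MvPolynomial.coe_aeval_eq_eval]
    simp only [RingHom.coe_coe]
    rw [← AlgHom.comp_apply, comp_aeval]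
    simp
  have h2 := coeff_aeval_scale (fun j => (2 : ℂ) ^ weight n j) P m
  rw [h1] at h2
  have h3 : (m.prod fun j e => ((2 : ℂ) ^ weight n j) ^ e) = 1 :=
    mul_right_cancel₀ hm (by rw [← h2, one_mul])
  rw [Finsupp.prod_fintype _ _ (by simp)] at h3
  have h4 : ∀ s : Finset (Idx n), ∏ j ∈ s, ((2 : ℂ) ^ weight n j) ^ (m j) =
      2 ^ (∑ j ∈ s, (m j : ℤ) * weight n j) := by
    classical
    intro s
    induction s using Finset.induction_on with
    | empty => simp
    | insert a s ha ih =>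
      rw [Finset.prod_insert ha, Finset.sum_insert ha, ih, zpow_add₀ two_ne_zero,
        mul_comm (m a : ℤ), zpow_mul, zpow_natCast]
  rw [h4] at h3
  have h5 : ((2 : ℝ)) ^ (∑ j, (m j : ℤ) * weight n j) = 1 := by
    have := congrArg (fun z : ℂ => ‖z‖) h3
    simpa [norm_zpow] using this
  exact (zpow_eq_one_iff_right₀ (a := (2 : ℝ)) (by norm_num) (by norm_num)).mp h5

/-- The point `(a₀ x + a₁ y, 0, c₀ x⁴ + c₁ x³y + c₂ x²y² + c₃ xy³ + c₄ y⁴)` of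
`V₁ ⊕ V₂ ⊕ V₄`. -/
def pt (a₀ a₁ c₀ c₁ c₂ c₃ c₄ : ℂ) : Idx ![1, 2, 4] → ℂ
  | ⟨0, k⟩ => (![a₀, a₁] : Fin 2 → ℂ) k
  | ⟨1, _⟩ => 0
  | ⟨2, k⟩ => (![c₀, c₁, c₂, c₃, c₄] : Fin 5 → ℂ) k

theorem prod_idx {M : Type*} [CommMonoid M] (f : Idx ![1, 2, 4] → M) :
    ∏ j, f j = (f ⟨0, (0 : Fin 2)⟩ * f ⟨0, (1 : Fin 2)⟩) *
      (f ⟨1, (0 : Fin 3)⟩ * f ⟨1, (1 : Fin 3)⟩ * f ⟨1, (2 : Fin 3)⟩) *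
      (f ⟨2, (0 : Fin 5)⟩ * f ⟨2, (1 : Fin 5)⟩ * f ⟨2, (2 : Fin 5)⟩ * f ⟨2, (3 : Fin 5)⟩ *
        f ⟨2, (4 : Fin 5)⟩) := by
  rw [Fintype.prod_sigma, Fin.prod_univ_three]
  congr 1
  · congr 1
    · exact Fin.prod_univ_two _
    · exact Fin.prod_univ_three _
  · exact Fin.prod_univ_five _

theorem sum_idx {M : Type*} [AddCommMonoid M] (f : Idx ![1, 2, 4] → M) :
    ∑ j, f j = (f ⟨0, (0 : Fin 2)⟩ + f ⟨0, (1 : Fin 2)⟩) +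
      (f ⟨1, (0 : Fin 3)⟩ + f ⟨1, (1 : Fin 3)⟩ + f ⟨1, (2 : Fin 3)⟩) +
      (f ⟨2, (0 : Fin 5)⟩ + f ⟨2, (1 : Fin 5)⟩ + f ⟨2, (2 : Fin 5)⟩ + f ⟨2, (3 : Fin 5)⟩ +
        f ⟨2, (4 : Fin 5)⟩) :=
  prod_idx (M := Multiplicative M) f

theorem ptV124_eq : ptV124 = pt 1 0 0 0 0 4 0 := by
  funext ⟨i, k⟩
  fin_cases i <;> change Fin _ at k <;> fin_cases k <;> simp [ptV124, pt]

theorem formAt_zero (c : Idx ![1, 2, 4] → ℂ) : formAt ![1, 2, 4] c 0 =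
    C (c ⟨0, (0 : Fin 2)⟩) * X 0 + C (c ⟨0, (1 : Fin 2)⟩) * X 1 := by
  refine (Fin.sum_univ_two _).trans ?_
  simp

theorem sl2Act_inv_formAt_zero (h : Matrix.SpecialLinearGroup (Fin 2) ℂ)
    (c : Idx ![1, 2, 4] → ℂ) : sl2Act h⁻¹ (formAt ![1, 2, 4] c 0) =
      C (c ⟨0, (0 : Fin 2)⟩) * (C (h.1 0 0) * X 0 + C (h.1 0 1) * X 1) +
      C (c ⟨0, (1 : Fin 2)⟩) * (C (h.1 1 0) * X 0 + C (h.1 1 1) * X 1) := by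
  simp [formAt_zero, sl2Act]

theorem formAt_two (c : Idx ![1, 2, 4] → ℂ) : formAt ![1, 2, 4] c 2 =
    C (c ⟨2, (0 : Fin 5)⟩) * X 0 ^ 4 + C (c ⟨2, (1 : Fin 5)⟩) * X 0 ^ 3 * X 1 +
    C (c ⟨2, (2 : Fin 5)⟩) * X 0 ^ 2 * X 1 ^ 2 + C (c ⟨2, (3 : Fin 5)⟩) * X 0 * X 1 ^ 3 +
    C (c ⟨2, (4 : Fin 5)⟩) * X 1 ^ 4 := by
  refine (Fin.sum_univ_five _).trans ?_
  simp

theorem sl2Act_inv_formAt_two (h : Matrix.SpecialLinearGroup (Fin 2) ℂ)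
    (c : Idx ![1, 2, 4] → ℂ) : sl2Act h⁻¹ (formAt ![1, 2, 4] c 2) =
      C (c ⟨2, (0 : Fin 5)⟩) * (C (h.1 0 0) * X 0 + C (h.1 0 1) * X 1) ^ 4 +
      C (c ⟨2, (1 : Fin 5)⟩) * (C (h.1 0 0) * X 0 + C (h.1 0 1) * X 1) ^ 3 *
        (C (h.1 1 0) * X 0 + C (h.1 1 1) * X 1) +
      C (c ⟨2, (2 : Fin 5)⟩) * (C (h.1 0 0) * X 0 + C (h.1 0 1) * X 1) ^ 2 *
        (C (h.1 1 0) * X 0 + C (h.1 1 1) * X 1) ^ 2 +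
      C (c ⟨2, (3 : Fin 5)⟩) * (C (h.1 0 0) * X 0 + C (h.1 0 1) * X 1) *
        (C (h.1 1 0) * X 0 + C (h.1 1 1) * X 1) ^ 3 +
      C (c ⟨2, (4 : Fin 5)⟩) * (C (h.1 1 0) * X 0 + C (h.1 1 1) * X 1) ^ 4 := by
  simp [formAt_two, sl2Act]

theorem degree_and_weight {P : MvPolynomial (Idx ![1, 2, 4]) ℂ}
    (hP : P ∈ invariantRing ![1, 2, 4]) {d : ℕ} (hd : P.IsHomogeneous d)
    {m : Idx ![1, 2, 4] →₀ ℕ} (hm : coeff m P ≠ 0) :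
    (m ⟨0, (0 : Fin 2)⟩ + m ⟨0, (1 : Fin 2)⟩) +
      (m ⟨1, (0 : Fin 3)⟩ + m ⟨1, (1 : Fin 3)⟩ + m ⟨1, (2 : Fin 3)⟩) +
      (m ⟨2, (0 : Fin 5)⟩ + m ⟨2, (1 : Fin 5)⟩ + m ⟨2, (2 : Fin 5)⟩ + m ⟨2, (3 : Fin 5)⟩ +
        m ⟨2, (4 : Fin 5)⟩) = d ∧
    m ⟨0, (1 : Fin 2)⟩ + 2 * m ⟨1, (2 : Fin 3)⟩ + 2 * m ⟨2, (3 : Fin 5)⟩ + 4 * m ⟨2, (4 : Fin 5)⟩ =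
      m ⟨0, (0 : Fin 2)⟩ + 2 * m ⟨1, (0 : Fin 3)⟩ + 2 * m ⟨2, (1 : Fin 5)⟩ +
        4 * m ⟨2, (0 : Fin 5)⟩ := by
  constructor
  · rw [← sum_idx (fun j => m j), ← Finsupp.degree_eq_sum]
    by_contra h
    exact hm (hd.coeff_eq_zero h)
  · have h1 := weight_eq_zero_of_coeff_ne_zero hP hm
    rw [sum_idx] at h1
    simp [weight] at h1
    omega

theorem eval_pt_eq_sum (P : MvPolynomial (Idx ![1, 2, 4]) ℂ) (a₀ a₁ c₀ c₁ c₂ c₃ c₄ : ℂ) :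
    eval (pt a₀ a₁ c₀ c₁ c₂ c₃ c₄) P = ∑ m ∈ P.support, coeff m P *
      ((a₀ ^ m ⟨0, (0 : Fin 2)⟩ * a₁ ^ m ⟨0, (1 : Fin 2)⟩) *
      (0 ^ m ⟨1, (0 : Fin 3)⟩ * 0 ^ m ⟨1, (1 : Fin 3)⟩ * 0 ^ m ⟨1, (2 : Fin 3)⟩) *
      (c₀ ^ m ⟨2, (0 : Fin 5)⟩ * c₁ ^ m ⟨2, (1 : Fin 5)⟩ * c₂ ^ m ⟨2, (2 : Fin 5)⟩ *
        c₃ ^ m ⟨2, (3 : Fin 5)⟩ * c₄ ^ m ⟨2, (4 : Fin 5)⟩)) := by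
  rw [eval_eq']
  simp only [prod_idx]
  rfl

section LowDegree

variable {P : MvPolynomial (Idx ![1, 2, 4]) ℂ} {d : ℕ}

theorem eval_pt_x_xy3_eq_zero (hP : P ∈ invariantRing ![1, 2, 4]) (hd : P.IsHomogeneous d)
    (h3 : ¬ 3 ∣ d) (a c : ℂ) : eval (pt a 0 0 0 0 c 0) P = 0 := by
  rw [eval_pt_eq_sum]
  refine Finset.sum_eq_zero fun m hm => ?_
  obtain ⟨h1, h2⟩ := degree_and_weight hP hd (mem_support_iff.mp hm)
  by_contra h
  simp only [mul_eq_zero, not_or, pow_eq_zero_iff', not_and, not_not, ne_eq, true_and] at h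
  omega

theorem eval_pt_zero_xy3_eq_zero (hP : P ∈ invariantRing ![1, 2, 4]) (hd : P.IsHomogeneous d)
    (h0 : 0 < d) (c : ℂ) : eval (pt 0 0 0 0 0 c 0) P = 0 := by
  rw [eval_pt_eq_sum]
  refine Finset.sum_eq_zero fun m hm => ?_
  obtain ⟨h1, h2⟩ := degree_and_weight hP hd (mem_support_iff.mp hm)
  by_contra h
  simp only [mul_eq_zero, not_or, pow_eq_zero_iff', not_and, not_not, ne_eq, true_and] at h
  omega

theorem eval_pt_x_y4_eq_zero (hP : P ∈ invariantRing ![1, 2, 4]) (hd : P.IsHomogeneous d)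
    (h5 : ¬ 5 ∣ d) (a c : ℂ) : eval (pt a 0 0 0 0 0 c) P = 0 := by
  rw [eval_pt_eq_sum]
  refine Finset.sum_eq_zero fun m hm => ?_
  obtain ⟨h1, h2⟩ := degree_and_weight hP hd (mem_support_iff.mp hm)
  by_contra h
  simp only [mul_eq_zero, not_or, pow_eq_zero_iff', not_and, not_not, ne_eq, true_and] at h
  omega

/-- The only monomial of a cubic invariant involving `a₀` but not `a₁` or the `V₂`-coordinates
is `a₀² c₃`. -/
theorem eval_pt_sub_eval_pt (hP : P ∈ invariantRing ![1, 2, 4]) (hd : P.IsHomogeneous 3)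
    (a c₀ c₁ c₂ c₃ c₄ e₀ e₁ e₂ e₄ : ℂ) :
    eval (pt a 0 c₀ c₁ c₂ c₃ c₄) P - eval (pt 0 0 c₀ c₁ c₂ c₃ c₄) P =
      eval (pt a 0 e₀ e₁ e₂ c₃ e₄) P - eval (pt 0 0 e₀ e₁ e₂ c₃ e₄) P := by
  simp only [eval_pt_eq_sum, ← Finset.sum_sub_distrib, ← mul_sub]
  refine Finset.sum_congr rfl fun m hm => ?_
  obtain ⟨h1, h2⟩ := degree_and_weight hP hd (mem_support_iff.mp hm)
  congr 1
  by_cases ha : m ⟨0, (0 : Fin 2)⟩ = 0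
  · simp [ha]
  by_cases ha1 : m ⟨0, (1 : Fin 2)⟩ = 0
  swap
  · simp [ha1]
  by_cases hb0 : m ⟨1, (0 : Fin 3)⟩ = 0
  swap
  · simp [hb0]
  by_cases hb1 : m ⟨1, (1 : Fin 3)⟩ = 0
  swap
  · simp [hb1]
  by_cases hb2 : m ⟨1, (2 : Fin 3)⟩ = 0
  swap
  · simp [hb2]
  have e0 : m ⟨2, (0 : Fin 5)⟩ = 0 := by omega
  have e1 : m ⟨2, (1 : Fin 5)⟩ = 0 := by omega
  have e2 : m ⟨2, (2 : Fin 5)⟩ = 0 := by omega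
  have e4 : m ⟨2, (4 : Fin 5)⟩ = 0 := by omega
  simp only [e0, e1, e2, e4, pow_zero]

/-- The unipotent substitution `x ↦ x`, `y ↦ x + y`. -/
def unip : Matrix.SpecialLinearGroup (Fin 2) ℂ :=
  ⟨!![1, 0; 1, 1], by simp [Matrix.det_fin_two]⟩

theorem actPt_unip (a : ℂ) :
    actPt ![1, 2, 4] unip⁻¹ (pt a 0 0 0 0 0 1) = pt a 0 1 4 6 4 1 := by
  have e : unip.1 = !![1, 0; 1, 1] := rfl
  funext ⟨i, k⟩
  apply actPt_apply_of_form
  fin_cases i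
  · refine (sl2Act_inv_formAt_zero _ _).trans (Eq.trans ?_ (formAt_zero _).symm)
    simp [pt, e]
  · simp [formAt, pt, sl2Act]
  · refine (sl2Act_inv_formAt_two _ _).trans (Eq.trans ?_ (formAt_two _).symm)
    simp [pt, e, (map_ofNat C 4 : (C 4 : MvPolynomial (Fin 2) ℂ) = 4),
      (map_ofNat C 6 : (C 6 : MvPolynomial (Fin 2) ℂ) = 6)]
    ring

theorem eval_ptV124_eq_zero (hP : P ∈ invariantRing ![1, 2, 4]) (h0 : 0 < d) (h5 : d ≤ 5)
    (hd : P.IsHomogeneous d) : eval ptV124 P = 0 := by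
  rw [ptV124_eq]
  by_cases h3 : d = 3
  · subst h3
    have h1 := hP unip⁻¹ (pt 1 0 0 0 0 0 1)
    have h2 := hP unip⁻¹ (pt 0 0 0 0 0 0 1)
    rw [actPt_unip, eval_pt_x_y4_eq_zero hP hd (by norm_num)] at h1 h2
    have h := eval_pt_sub_eval_pt hP hd 1 1 4 6 4 1 0 0 0 0
    rw [h1, h2, eval_pt_zero_xy3_eq_zero hP hd h0] at h
    simpa using h.symm
  · exact eval_pt_x_xy3_eq_zero hP hd (by omega) _ _

end LowDegree

section HessianInvariant

/-- The second partial derivatives of the quartic component, evaluated at the zero `(-a₁, a₀)`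
of the linear component. -/
def hessEntry : Fin 3 → MvPolynomial (Idx ![1, 2, 4]) ℂ :=
  let a₀ := X ⟨0, (0 : Fin 2)⟩
  let a₁ := X ⟨0, (1 : Fin 2)⟩
  let c : Fin 5 → MvPolynomial (Idx ![1, 2, 4]) ℂ := fun k => X ⟨2, k⟩
  ![C 12 * (c 0 * a₁ * a₁) - C 6 * (c 1 * a₁ * a₀) + C 2 * (c 2 * a₀ * a₀),
    C 3 * (c 1 * a₁ * a₁) - C 4 * (c 2 * a₁ * a₀) + C 3 * (c 3 * a₀ * a₀),
    C 2 * (c 2 * a₁ * a₁) - C 6 * (c 3 * a₁ * a₀) + C 12 * (c 4 * a₀ * a₀)]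

/-- The Hessian of the quartic component, evaluated at the zero of the linear component. -/
def hessInvariant : MvPolynomial (Idx ![1, 2, 4]) ℂ :=
  hessEntry 0 * hessEntry 2 - hessEntry 1 * hessEntry 1

theorem hessEntry_isHomogeneous (i : Fin 3) : (hessEntry i).IsHomogeneous 3 := by
  have h : ∀ (r : ℂ) (i j k : Idx ![1, 2, 4]), (C r * (X i * X j * X k)).IsHomogeneous 3 :=
    fun r i j k => (((isHomogeneous_X ℂ i).mul (isHomogeneous_X ℂ j)).mul
      (isHomogeneous_X ℂ k)).C_mul r
  fin_cases i <;> exact ((h _ _ _ _).sub (h _ _ _ _)).add (h _ _ _ _)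

theorem hessInvariant_isHomogeneous : hessInvariant.IsHomogeneous 6 :=
  ((hessEntry_isHomogeneous 0).mul (hessEntry_isHomogeneous 2)).sub
    ((hessEntry_isHomogeneous 1).mul (hessEntry_isHomogeneous 1))

theorem eval_hessInvariant (c : Idx ![1, 2, 4] → ℂ) :
    eval c hessInvariant =
      eval c (hessEntry 0) * eval c (hessEntry 2) - eval c (hessEntry 1) ^ 2 := by
  simp only [hessInvariant, map_sub, map_mul, sq]

theorem hessInvariant_mem : hessInvariant ∈ invariantRing ![1, 2, 4] := by
  intro g c
  obtain ⟨h, rfl⟩ : ∃ h, g = h⁻¹ := ⟨g⁻¹, (inv_inv g).symm⟩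
  have hdet : h.1 0 0 * h.1 1 1 - h.1 0 1 * h.1 1 0 = 1 := by
    rw [← Matrix.det_fin_two]; exact h.2
  have A := actPt_apply_of_form (i := 0) (g := h⁻¹) (c := c)
    (c' := pt (c ⟨0, (0 : Fin 2)⟩ * h.1 0 0 + c ⟨0, (1 : Fin 2)⟩ * h.1 1 0)
      (c ⟨0, (0 : Fin 2)⟩ * h.1 0 1 + c ⟨0, (1 : Fin 2)⟩ * h.1 1 1) 0 0 0 0 0) (by
    rw [sl2Act_inv_formAt_zero, formAt_zero]
    simp [pt]
    ring)
  obtain ⟨α, hα⟩ : ∃ α, h.1 0 0 = α := ⟨_, rfl⟩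
  obtain ⟨β, hβ⟩ : ∃ β, h.1 0 1 = β := ⟨_, rfl⟩
  obtain ⟨γ, hγ⟩ : ∃ γ, h.1 1 0 = γ := ⟨_, rfl⟩
  obtain ⟨δ, hδ⟩ : ∃ δ, h.1 1 1 = δ := ⟨_, rfl⟩
  obtain ⟨u, hu⟩ : ∃ u : Fin 5 → ℂ, ∀ k : Fin 5, c ⟨2, k⟩ = u k := ⟨_, fun _ => rfl⟩
  obtain ⟨a, ha⟩ : ∃ a : Fin 2 → ℂ, ∀ k : Fin 2, c ⟨0, k⟩ = a k := ⟨_, fun _ => rfl⟩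
  have B := actPt_apply_of_form (i := 2) (g := h⁻¹) (c := c)
    (c' := pt 0 0
      (u 0 * α ^ 4 + u 1 * α ^ 3 * γ + u 2 * α ^ 2 * γ ^ 2 + u 3 * α * γ ^ 3 + u 4 * γ ^ 4)
      (4 * u 0 * α ^ 3 * β + u 1 * (3 * α ^ 2 * β * γ + α ^ 3 * δ) +
        u 2 * (2 * α * β * γ ^ 2 + 2 * α ^ 2 * γ * δ) +
        u 3 * (β * γ ^ 3 + 3 * α * γ ^ 2 * δ) + 4 * u 4 * γ ^ 3 * δ)
      (6 * u 0 * α ^ 2 * β ^ 2 + u 1 * (3 * α * β ^ 2 * γ + 3 * α ^ 2 * β * δ) +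
        u 2 * (β ^ 2 * γ ^ 2 + 4 * α * β * γ * δ + α ^ 2 * δ ^ 2) +
        u 3 * (3 * β * γ ^ 2 * δ + 3 * α * γ * δ ^ 2) + 6 * u 4 * γ ^ 2 * δ ^ 2)
      (4 * u 0 * α * β ^ 3 + u 1 * (β ^ 3 * γ + 3 * α * β ^ 2 * δ) +
        u 2 * (2 * β ^ 2 * γ * δ + 2 * α * β * δ ^ 2) +
        u 3 * (3 * β * γ * δ ^ 2 + α * δ ^ 3) + 4 * u 4 * γ * δ ^ 3)
      (u 0 * β ^ 4 + u 1 * β ^ 3 * δ + u 2 * β ^ 2 * δ ^ 2 + u 3 * β * δ ^ 3 + u 4 * δ ^ 4)) (by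
    rw [sl2Act_inv_formAt_two, formAt_two]
    simp [pt, hu, hα, hβ, hγ, hδ, (map_ofNat C 2 : (C 2 : MvPolynomial (Fin 2) ℂ) = 2),
      (map_ofNat C 3 : (C 3 : MvPolynomial (Fin 2) ℂ) = 3),
      (map_ofNat C 4 : (C 4 : MvPolynomial (Fin 2) ℂ) = 4),
      (map_ofNat C 6 : (C 6 : MvPolynomial (Fin 2) ℂ) = 6)]
    ring)
  rw [hα, hβ, hγ, hδ] at A
  rw [hα, hβ, hγ, hδ] at hdet
  have A0 := A (0 : Fin 2)
  have A1 := A (1 : Fin 2)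
  have B0 := B (0 : Fin 5)
  have B1 := B (1 : Fin 5)
  have B2 := B (2 : Fin 5)
  have B3 := B (3 : Fin 5)
  have B4 := B (4 : Fin 5)
  simp only [pt, ha, Matrix.cons_val] at A0 A1 B0 B1 B2 B3 B4
  have E0 : eval (actPt ![1, 2, 4] h⁻¹ c) (hessEntry 0) = (α * δ - β * γ) ^ 2 *
      (α ^ 2 * eval c (hessEntry 0) + 2 * α * γ * eval c (hessEntry 1) +
        γ ^ 2 * eval c (hessEntry 2)) := by
    simp [hessEntry, A0, A1, B0, B1, B2, ha, hu]
    ring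
  have E1 : eval (actPt ![1, 2, 4] h⁻¹ c) (hessEntry 1) = (α * δ - β * γ) ^ 2 *
      (α * β * eval c (hessEntry 0) + (α * δ + β * γ) * eval c (hessEntry 1) +
        γ * δ * eval c (hessEntry 2)) := by
    simp [hessEntry, A0, A1, B1, B2, B3, ha, hu]
    ring
  have E2 : eval (actPt ![1, 2, 4] h⁻¹ c) (hessEntry 2) = (α * δ - β * γ) ^ 2 *
      (β ^ 2 * eval c (hessEntry 0) + 2 * β * δ * eval c (hessEntry 1) +
        δ ^ 2 * eval c (hessEntry 2)) := by
    simp [hessEntry, A0, A1, B2, B3, B4, ha, hu]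
    ring
  have E : eval (actPt ![1, 2, 4] h⁻¹ c) hessInvariant =
      (α * δ - β * γ) ^ 6 * eval c hessInvariant := by
    rw [eval_hessInvariant, eval_hessInvariant, E0, E1, E2]
    ring
  rw [E, hdet, one_pow, one_mul]

theorem eval_ptV124_hessInvariant : eval ptV124 hessInvariant ≠ 0 := by
  rw [ptV124_eq]
  simp [eval_hessInvariant, hessEntry, pt]

end HessianInvariant

theorem eval_smul_of_isHomogeneous {σ : Type*} {P : MvPolynomial σ ℂ} {d : ℕ}
    (hd : P.IsHomogeneous d) (t : ℂ) (c : σ → ℂ) : eval (t • c) P = t ^ d * eval c P := by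
  rw [eval_eq, eval_eq, Finset.mul_sum]
  refine Finset.sum_congr rfl fun m hm => ?_
  have h : ∑ j ∈ m.support, m j = d := by
    by_contra h
    exact mem_support_iff.mp hm (hd.coeff_eq_zero h)
  simp only [Pi.smul_apply, smul_eq_mul, mul_pow, Finset.prod_mul_distrib,
    Finset.prod_pow_eq_pow_sum, h]
  ring

/-- If a point is a common zero of a homogeneous system of parameters, it lies in the
nullcone. -/
theorem IsHSOP.mem_nullcone {k : ℕ} {P : Fin k → MvPolynomial (Idx n) ℂ} {d : Fin k → ℕ}
    (hP : IsHSOP n P d) {c : Idx n → ℂ} (hc : ∀ j, eval c (P j) = 0) : c ∈ Nullcone n := by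
  obtain ⟨-, hpos, hhom, -, hint⟩ := hP
  intro Q hQ e he hQe
  by_contra hne
  obtain ⟨f, hf, hroot⟩ := hint Q hQ
  have hconst : ∀ (t : ℂ) (a : Algebra.adjoin ℂ (Set.range P)),
      eval (t • c) a.1 = eval (0 : Idx n → ℂ) a.1 := by
    rintro t ⟨a, ha⟩
    refine Algebra.adjoin_induction (p := fun a _ => eval (t • c) a = eval 0 a)
      ?_ ?_ ?_ ?_ ha
    · rintro _ ⟨j, rfl⟩
      have h0 := eval_smul_of_isHomogeneous (hhom j) 0 c
      rw [zero_smul] at h0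
      rw [eval_smul_of_isHomogeneous (hhom j), h0, hc, mul_zero, mul_zero]
    · intro r; simp [algebraMap_eq]
    · intro x y _ _ hx hy; simp only [map_add, hx, hy]
    · intro x y _ _ hx hy; simp only [map_mul, hx, hy]
  let φ : Algebra.adjoin ℂ (Set.range P) →+* ℂ :=
    (eval (0 : Idx n → ℂ)).comp (algebraMap _ (MvPolynomial (Idx n) ℂ))
  have hzero : ∀ z : ℂ, (f.map φ).eval z = 0 := by
    intro z
    obtain ⟨t, ht⟩ := IsAlgClosed.exists_pow_nat_eq (z / eval c Q) he
    have h1 := congrArg (eval (t • c)) hroot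
    rw [Polynomial.hom_eval₂, map_zero, eval_smul_of_isHomogeneous hQe, ht,
      div_mul_cancel₀ _ hne] at h1
    rw [Polynomial.eval_map, ← h1]
    congr 1
    ext a
    exact (hconst t a).symm
  have h0 : f.map φ = 0 := Polynomial.funext fun z => by rw [hzero, Polynomial.eval_zero]
  exact (hf.map φ).ne_zero h0

theorem ptV124_notMem_nullcone : ptV124 ∉ Nullcone ![1, 2, 4] := fun h =>
  eval_ptV124_hessInvariant
    (h _ hessInvariant_mem 6 (by norm_num) hessInvariant_isHomogeneous)

end BinInv

open BinInv in
/-- For `V = V₁ ⊕ V₂ ⊕ V₄`, there is no homogeneous system of parameters of degrees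
`2, 2, 3, 3, 3, 4, 5`: indeed every homogeneous invariant of degree at most `5`
vanishes at the point `(x, 0, 4xy³)`, which is not in the nullcone. -/
theorem V1_V2_V4_no_hsop :
    (¬ ∃ P : Fin 7 → MvPolynomial (Idx ![1, 2, 4]) ℂ,
      IsHSOP ![1, 2, 4] P ![2, 2, 3, 3, 3, 4, 5]) ∧
    (∀ P ∈ invariantRing ![1, 2, 4], ∀ d : ℕ, 0 < d → d ≤ 5 →
      P.IsHomogeneous d → eval ptV124 P = 0) ∧
    ptV124 ∉ Nullcone ![1, 2, 4] := by
  refine ⟨?_, fun P hP d h0 h5 hd => eval_ptV124_eq_zero hP h0 h5 hd, ptV124_notMem_nullcone⟩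
  rintro ⟨P, hP⟩
  refine ptV124_notMem_nullcone (hP.mem_nullcone fun j => ?_)
  refine eval_ptV124_eq_zero (hP.1 j) (hP.2.1 j) ?_ (hP.2.2.1 j)
  fin_cases j <;> simp

end
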